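/- Let 1 ≤ p < ∞, κ > 0 and τ > 0. Then there exists a constant C = C(κ, τ, p) > 0 such that for every compact metric measure space (X, υ) with X a geodesic space containing more than one point, satisfying the doubling condition for κ and the (1, p)-Poincaré inequality for τ, one has λ_{1,p}(X)^{1/p} ≥ 1/(C · diam X), where λ_{1,1}(X) := h(X) and diam X is the diameter of X. -/

import Mathlib

open MeasureTheory Metric Filter Set
open scoped Topology NNReal ENNReal
open Classical

variable {X : Type*} [MetricSpace X]

/-- A real-valued function is Lipschitz (with some constant). -/
def IsLipFun (f : X → ℝ) : Prop := ∃ K : ℝ≥0, LipschitzWith K f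

/-- The pointwise Lipschitz constant `Lip f (x)`:
`0` if `x` is isolated, and otherwise the limit (= infimum, by monotonicity)
as `r → 0` of `sup_{y ∈ B_r(x), y ≠ x} |f x - f y| / dist x y`. -/
noncomputable def pLip (f : X → ℝ) (x : X) : ℝ :=
  if 𝓝[≠] x = ⊥ then 0
  else ⨅ r : Ioi (0:ℝ), sSup ((fun y => |f x - f y| / dist x y) '' (ball x r.1 \ {x}))

/-- `γ` is a (unit-speed) minimal geodesic from `x` to `y`. -/
def IsMinGeodesic (γ : ℝ → X) (x y : X) : Prop :=
  γ 0 = x ∧ γ (dist x y) = y ∧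
    ∀ s ∈ Icc (0:ℝ) (dist x y), ∀ t ∈ Icc (0:ℝ) (dist x y), dist (γ s) (γ t) = |s - t|

/-- A metric space is geodesic if any two points are joined by a minimal geodesic. -/
def IsGeodesicSpace (Y : Type*) [MetricSpace Y] : Prop :=
  ∀ x y : Y, ∃ γ : ℝ → Y, IsMinGeodesic γ x y

section MeasureDefs
variable [MeasurableSpace X] (υ : Measure X)

/-- The doubling condition for `κ`. -/
def DoublingFor (κ : ℝ) : Prop :=
  ∀ x : X, ∀ r : ℝ, 0 < r → υ (ball x (2*r)) ≤ (2:ℝ≥0∞) ^ κ * υ (ball x r)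

/-- The `(q,p)`-Poincaré inequality for `τ` (for Lipschitz functions). -/
def PoincareFor (q p τ : ℝ) : Prop :=
  ∀ x : X, ∀ r : ℝ, 0 < r → ∀ f : X → ℝ, IsLipFun f →
    (⨍ y in ball x r, |f y - ⨍ z in ball x r, f z ∂υ| ^ q ∂υ) ^ (1/q) ≤
      τ * r * ((⨍ y in ball x r, (pLip f y) ^ p ∂υ) ^ (1/p))

/-- `F_g(x,y)`: the infimum over minimal geodesics `γ` from `x` to `y` of
`∫_0^{d(x,y)} g(γ(s)) ds`. -/
noncomputable def segF (g : X → ℝ≥0∞) (x y : X) : ℝ≥0∞ :=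
  ⨅ γ ∈ {γ : ℝ → X | IsMinGeodesic γ x y}, ∫⁻ s in Icc (0:ℝ) (dist x y), g (γ s)

/-- The segment inequality for `lam`. -/
def SegmentIneqFor (lam : ℝ) : Prop :=
  ∀ x : X, ∀ r : ℝ, 0 < r → ∀ g : X → ℝ≥0∞, Measurable g →
    (∫⁻ pr in (ball x r) ×ˢ (ball x r), segF g pr.1 pr.2 ∂(υ.prod υ)) ≤
      ENNReal.ofReal (lam * r) * υ (ball x r) * ∫⁻ z in ball x (3*r), g z ∂υ

/-- The first eigenvalue of the `p`-Laplacian (`∞` if there is no competitor). -/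
noncomputable def lambda1 (p : ℝ) : ℝ≥0∞ :=
  ⨅ f ∈ {f : X → ℝ | IsLipFun f ∧ (∫ x, |f x| ^ p ∂υ) = 1 ∧
      (∫ x, |f x| ^ (p-2) * f x ∂υ) = 0},
    ENNReal.ofReal (∫ x, (pLip f x) ^ p ∂υ)

/-- Minkowski's exterior boundary measure
`υ⁺(A) = liminf_{r → 0+} (υ(B_r(A)) - υ(A))/r`. -/
noncomputable def minkBoundary (A : Set X) : ℝ≥0∞ :=
  Filter.liminf (fun r : ℝ => (υ (thickening r A) - υ A) / ENNReal.ofReal r) (𝓝[>] (0:ℝ))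

/-- The Cheeger constant (`∞` if there is no competitor). -/
noncomputable def cheeger : ℝ≥0∞ :=
  ⨅ A ∈ {A : Set X | MeasurableSet A ∧ 0 < υ A ∧ υ A ≤ 1/2}, minkBoundary υ A / υ A

/-- `λ_{1,p}` for `p ∈ [1, ∞)`, with `λ_{1,1} := h(X)` the Cheeger constant. -/
noncomputable def lam1 (p : ℝ) : ℝ≥0∞ := if p = 1 then cheeger υ else lambda1 υ p

/-- `c_p(f) = inf_{c ∈ ℝ} (∫ |f - c|^p dυ)^{1/p}`. -/
noncomputable def cP (p : ℝ) (f : X → ℝ) : ℝ :=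
  ⨅ c : ℝ, (∫ x, |f x - c| ^ p ∂υ) ^ (1/p)

/-- `M` is a median of `f`. -/
def IsMedian (f : X → ℝ) (M : ℝ) : Prop :=
  (1/2 : ℝ≥0∞) ≤ υ {x | M ≤ f x} ∧ (1/2 : ℝ≥0∞) ≤ υ {x | f x ≤ M}

end MeasureDefs

/-- The global Lipschitz constant `sup_{a ≠ b} |f a - f b| / dist a b`. -/
noncomputable def globalLip (f : X → ℝ) : ℝ :=
  sSup {L : ℝ | ∃ a b : X, a ≠ b ∧ L = |f a - f b| / dist a b}

lemma pLip_nonneg (f : X → ℝ) (x : X) : 0 ≤ pLip f x := by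
  unfold pLip
  split_ifs
  · exact le_rfl
  · refine Real.iInf_nonneg fun r => Real.sSup_nonneg ?_
    rintro _ ⟨y, -, rfl⟩
    positivity

lemma LipschitzWith.abs_sub_div_dist_le {f : X → ℝ} {K : ℝ≥0} (hf : LipschitzWith K f) (x y : X) :
    |f x - f y| / dist x y ≤ K :=
  div_le_of_le_mul₀ dist_nonneg K.2 (by simpa [Real.dist_eq] using hf.dist_le_mul x y)

lemma bddBelow_range_sSup_slopes (f : X → ℝ) (x : X) :
    BddBelow (Set.range fun r : Ioi (0 : ℝ) =>
      sSup ((fun y => |f x - f y| / dist x y) '' (ball x r.1 \ {x}))) := by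
  refine ⟨0, ?_⟩
  rintro _ ⟨r, rfl⟩
  refine Real.sSup_nonneg ?_
  rintro _ ⟨y, -, rfl⟩
  positivity

lemma pLip_le_of_lipschitzWith {f : X → ℝ} {K : ℝ≥0} (hf : LipschitzWith K f) (x : X) :
    pLip f x ≤ K := by
  unfold pLip
  split_ifs
  · exact K.2
  · refine (ciInf_le (bddBelow_range_sSup_slopes f x) ⟨1, mem_Ioi.2 one_pos⟩).trans
      (Real.sSup_le ?_ K.2)
    rintro _ ⟨y, -, rfl⟩
    exact hf.abs_sub_div_dist_le x y

lemma pLip_eq_zero_of_eventually_eq {f : X → ℝ} {x : X} (h : ∀ᶠ y in 𝓝 x, f y = f x) :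
    pLip f x = 0 := by
  refine le_antisymm ?_ (pLip_nonneg f x)
  unfold pLip
  split_ifs
  · exact le_rfl
  · obtain ⟨r, hr, hball⟩ := Metric.eventually_nhds_iff_ball.1 h
    refine (ciInf_le (bddBelow_range_sSup_slopes f x) ⟨r, hr⟩).trans (Real.sSup_le ?_ le_rfl)
    rintro _ ⟨y, hy, rfl⟩
    simp [hball y hy.1]

/-- The supremum of slopes on a ball of fixed radius is lower semicontinuous in the centre. -/
lemma lowerSemicontinuous_sSup_slopes {f : X → ℝ} {K : ℝ≥0} (hf : LipschitzWith K f) (r : ℝ) :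
    LowerSemicontinuous fun x =>
      sSup ((fun y => |f x - f y| / dist x y) '' (ball x r \ {x})) := by
  have hbdd : ∀ x, BddAbove ((fun y => |f x - f y| / dist x y) '' (ball x r \ {x})) := by
    intro x
    refine ⟨K, ?_⟩
    rintro _ ⟨y, -, rfl⟩
    exact hf.abs_sub_div_dist_le x y
  intro x c hc
  rcases Set.eq_empty_or_nonempty ((fun y => |f x - f y| / dist x y) '' (ball x r \ {x}))
    with he | hne
  · simp only [he, Real.sSup_empty] at hc
    refine Eventually.of_forall fun z => hc.trans_le (Real.sSup_nonneg ?_)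
    rintro _ ⟨y, -, rfl⟩
    positivity
  · obtain ⟨_, ⟨y, hy, rfl⟩, hcy⟩ := exists_lt_of_lt_csSup hne hc
    have hxy : dist x y ≠ 0 := dist_ne_zero.2 fun h => hy.2 h.symm
    have hcont : ContinuousAt (fun z => |f z - f y| / dist z y) x :=
      ((hf.continuous.continuousAt.sub continuousAt_const).abs).div
        (continuousAt_id.dist continuousAt_const) hxy
    have hdist : ContinuousAt (fun z => dist z y) x := continuousAt_id.dist continuousAt_const
    have hlt : dist x y < r := by simpa [dist_comm] using hy.1
    filter_upwards [hcont.eventually_const_lt hcy, hdist.eventually_lt_const hlt,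
      hdist.eventually_ne hxy] with z h1 h2 h3
    refine h1.trans_le (le_csSup (hbdd z) ⟨y, ⟨?_, ?_⟩, rfl⟩)
    · simpa [dist_comm] using h2
    · exact fun h => h3 (by simp [Set.mem_singleton_iff.1 h])

lemma measurable_pLip [MeasurableSpace X] [BorelSpace X] {f : X → ℝ} {K : ℝ≥0}
    (hf : LipschitzWith K f) : Measurable (pLip f) := by
  unfold pLip
  refine Measurable.ite ?_ measurable_const ?_
  · refine IsOpen.measurableSet (isOpen_iff_mem_nhds.2 fun x hx => ?_)
    have hx' : ({x} : Set X) ∈ 𝓝 x :=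
      ((isOpen_singleton_iff_punctured_nhds x).2 hx).mem_nhds rfl
    filter_upwards [hx'] with y hy
    rw [Set.mem_singleton_iff.1 hy]
    exact hx
  · refine measurable_of_Iio fun c => ?_
    have : (fun x => ⨅ r : Ioi (0:ℝ),
          sSup ((fun y => |f x - f y| / dist x y) '' (ball x r.1 \ {x}))) ⁻¹' Iio c =
        ⋃ n : ℕ, (fun x => sSup ((fun y => |f x - f y| / dist x y) ''
          (ball x (1 / ((n : ℝ) + 1)) \ {x}))) ⁻¹' Iio c := by
      ext x
      simp only [mem_preimage, mem_Iio, mem_iUnion]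
      constructor
      · intro h
        obtain ⟨r, hr⟩ := exists_lt_of_ciInf_lt h
        obtain ⟨n, hn⟩ := exists_nat_one_div_lt (mem_Ioi.1 r.2)
        refine ⟨n, lt_of_le_of_lt ?_ hr⟩
        refine Real.sSup_le ?_ (Real.sSup_nonneg ?_)
        · rintro _ ⟨y, hy, rfl⟩
          refine le_csSup ⟨K, ?_⟩ ⟨y, ⟨ball_subset_ball hn.le hy.1, hy.2⟩, rfl⟩
          rintro _ ⟨z, -, rfl⟩
          exact hf.abs_sub_div_dist_le x z
        · rintro _ ⟨y, -, rfl⟩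
          positivity
      · rintro ⟨n, hn⟩
        exact (ciInf_le (bddBelow_range_sSup_slopes f x) ⟨1 / ((n : ℝ) + 1),
          mem_Ioi.2 Nat.one_div_pos_of_nat⟩).trans_lt hn
    rw [this]
    exact MeasurableSet.iUnion fun n =>
      (lowerSemicontinuous_sSup_slopes hf _).measurable measurableSet_Iio

lemma integrable_pLip_rpow [MeasurableSpace X] [BorelSpace X] {υ : Measure X}
    [IsProbabilityMeasure υ] {f : X → ℝ} (hf : IsLipFun f)
    {p : ℝ} (hp : 0 ≤ p) : Integrable (fun y => (pLip f y) ^ p) υ := by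
  obtain ⟨K, hK⟩ := hf
  refine Integrable.of_bound ((measurable_pLip hK).pow_const p).aestronglyMeasurable
    ((K : ℝ) ^ p) (Eventually.of_forall fun y => ?_)
  rw [Real.norm_of_nonneg (Real.rpow_nonneg (pLip_nonneg f y) p)]
  exact Real.rpow_le_rpow (pLip_nonneg f y) (pLip_le_of_lipschitzWith hK y) hp

section Doubling

variable [CompactSpace X]

lemma ball_eq_univ_of_diam_lt {r : ℝ} (hr : diam (univ : Set X) < r) (x : X) :
    ball x r = univ :=
  eq_univ_of_forall fun y =>
    (dist_le_diam_of_mem isCompact_univ.isBounded (mem_univ y) (mem_univ x)).trans_lt hr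

variable [MeasurableSpace X] {υ : Measure X}

lemma DoublingFor.measure_ball_pos [IsProbabilityMeasure υ] {κ : ℝ} (h : DoublingFor υ κ)
    (x : X) {r : ℝ} (hr : 0 < r) : 0 < υ (ball x r) := by
  rw [pos_iff_ne_zero]
  intro h0
  have hn : ∀ n : ℕ, υ (ball x (2 ^ n * r)) = 0 := by
    intro n
    induction n with
    | zero => simpa using h0
    | succ n ih =>
      have := h x (2 ^ n * r) (by positivity)
      rw [ih, mul_zero, nonpos_iff_eq_zero] at this
      rwa [pow_succ', mul_assoc]
  obtain ⟨n, hlt⟩ := pow_unbounded_of_one_lt (diam (univ : Set X) / r) one_lt_two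
  have := hn n
  rw [ball_eq_univ_of_diam_lt ((div_lt_iff₀ hr).1 hlt), measure_univ] at this
  exact one_ne_zero this

lemma two_rpow_eq_ofReal (κ : ℝ) : (2 : ℝ≥0∞) ^ κ = ENNReal.ofReal (2 ^ κ) := by
  rw [← ENNReal.ofReal_rpow_of_pos two_pos, ENNReal.ofReal_ofNat]

lemma DoublingFor.measureReal_le [IsProbabilityMeasure υ] {κ : ℝ} (h : DoublingFor υ κ)
    (x : X) {r : ℝ} (hr : 0 < r) :
    υ.real (ball x (2 * r)) ≤ 2 ^ κ * υ.real (ball x r) := by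
  have := ENNReal.toReal_mono (by finiteness) (h x r hr)
  rwa [two_rpow_eq_ofReal, ENNReal.toReal_mul,
    ENNReal.toReal_ofReal (by positivity)] at this

lemma PoincareFor.integral_abs_sub_integral_le [IsProbabilityMeasure υ] {p τ : ℝ}
    (hP : PoincareFor υ 1 p τ) {f : X → ℝ} (hf : IsLipFun f) (hd : 0 < diam (univ : Set X)) :
    ∫ x, |f x - ∫ y, f y ∂υ| ∂υ ≤
      τ * (2 * diam (univ : Set X)) * (∫ x, pLip f x ^ p ∂υ) ^ (1 / p) := by
  have : Nonempty X := by
    by_contra! hX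
    simp [univ_eq_empty_iff.2 hX] at hd
  obtain ⟨x⟩ := this
  have := hP x (2 * diam (univ : Set X)) (by positivity) f hf
  rw [ball_eq_univ_of_diam_lt (by linarith)] at this
  simpa [average_eq_integral] using this

variable [BorelSpace X]

lemma measurable_measure_ball [IsProbabilityMeasure υ] (r : ℝ) :
    Measurable fun x => υ (ball x r) := by
  have hs : MeasurableSet {q : X × X | dist q.2 q.1 < r} :=
    (isOpen_lt (continuous_snd.dist continuous_fst) continuous_const).measurableSet
  exact measurable_measure_prodMk_left hs

/-- Averaging over balls of a fixed radius is bounded on `L¹` of a doubling measure. -/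
lemma DoublingFor.lintegral_ball_average_le [IsProbabilityMeasure υ] {κ : ℝ}
    (h : DoublingFor υ κ) {r : ℝ} (hr : 0 < r) {g : X → ℝ≥0∞} (hg : Measurable g) :
    ∫⁻ x, (υ (ball x r))⁻¹ * ∫⁻ y in ball x r, g y ∂υ ∂υ ≤ 2 ^ κ * ∫⁻ y, g y ∂υ := by
  have hs : MeasurableSet {q : X × X | dist q.1 q.2 < r} :=
    (isOpen_lt (continuous_fst.dist continuous_snd) continuous_const).measurableSet
  have hpt : ∀ x y : X, (υ (ball x r))⁻¹ * (ball x r).indicator g y ≤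
      (ball y r).indicator (fun _ => 2 ^ κ * (υ (ball y r))⁻¹ * g y) x := by
    intro x y
    by_cases hxy : dist x y < r
    · rw [indicator_of_mem (by rwa [mem_ball']), indicator_of_mem (by rwa [mem_ball])]
      gcongr
      have hsub : ball y r ⊆ ball x (2 * r) :=
        ball_subset_ball' (by rw [dist_comm]; linarith)
      have := (measure_mono hsub).trans (h x r hr)
      have hx0 := (h.measure_ball_pos x hr).ne'
      have hy0 := (h.measure_ball_pos y hr).ne'
      calc (υ (ball x r))⁻¹
          = (υ (ball y r))⁻¹ * υ (ball y r) * (υ (ball x r))⁻¹ := by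
            rw [ENNReal.inv_mul_cancel hy0 (by finiteness), one_mul]
        _ ≤ (υ (ball y r))⁻¹ * (2 ^ κ * υ (ball x r)) * (υ (ball x r))⁻¹ := by gcongr
        _ = 2 ^ κ * (υ (ball y r))⁻¹ * (υ (ball x r) * (υ (ball x r))⁻¹) := by ring
        _ = 2 ^ κ * (υ (ball y r))⁻¹ := by
            rw [ENNReal.mul_inv_cancel hx0 (by finiteness), mul_one]
    · rw [indicator_of_notMem (by rwa [mem_ball'])]
      simp
  calc ∫⁻ x, (υ (ball x r))⁻¹ * ∫⁻ y in ball x r, g y ∂υ ∂υ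
      = ∫⁻ x, ∫⁻ y, (υ (ball x r))⁻¹ * (ball x r).indicator g y ∂υ ∂υ := by
        refine lintegral_congr fun x => ?_
        rw [lintegral_const_mul _ (hg.indicator measurableSet_ball),
          lintegral_indicator measurableSet_ball]
    _ ≤ ∫⁻ x, ∫⁻ y, (ball y r).indicator (fun _ => 2 ^ κ * (υ (ball y r))⁻¹ * g y) x ∂υ ∂υ :=
        lintegral_mono fun x => lintegral_mono fun y => hpt x y
    _ = ∫⁻ y, ∫⁻ x, (ball y r).indicator (fun _ => 2 ^ κ * (υ (ball y r))⁻¹ * g y) x ∂υ ∂υ := by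
        refine lintegral_lintegral_swap (Measurable.aemeasurable ?_)
        have : Measurable fun q : X × X => 2 ^ κ * (υ (ball q.2 r))⁻¹ * g q.2 :=
          ((((measurable_measure_ball r).inv).const_mul _).mul hg).comp measurable_snd
        exact this.indicator hs
    _ = ∫⁻ y, 2 ^ κ * g y ∂υ := by
        refine lintegral_congr fun y => ?_
        rw [lintegral_indicator measurableSet_ball, setLIntegral_const, mul_assoc, mul_assoc,
          mul_comm (g y), ← mul_assoc (υ (ball y r))⁻¹,
          ENNReal.inv_mul_cancel (h.measure_ball_pos y hr).ne' (by finiteness), one_mul]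
    _ = 2 ^ κ * ∫⁻ y, g y ∂υ := lintegral_const_mul _ hg

/-- Ball averages of a Lipschitz function at scales `r` and `2 * r` differ by at most the
right-hand side of the Poincaré inequality at scale `2 * r`. -/
lemma abs_average_sub_average_le [IsProbabilityMeasure υ] {κ τ p : ℝ}
    (h : DoublingFor υ κ) (hP : PoincareFor υ 1 p τ) {f : X → ℝ} (hf : IsLipFun f)
    (x : X) {r : ℝ} (hr : 0 < r) :
    |(⨍ y in ball x r, f y ∂υ) - ⨍ y in ball x (2 * r), f y ∂υ| ≤
      2 ^ κ * (τ * (2 * r) * (⨍ y in ball x (2 * r), (pLip f y) ^ p ∂υ) ^ (1 / p)) := by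
  obtain ⟨K, hK⟩ := hf
  have hP' := hP x (2 * r) (by positivity) f ⟨K, hK⟩
  simp only [Real.rpow_one, div_one] at hP'
  set c := ⨍ y in ball x (2 * r), f y ∂υ
  have hint : Integrable f υ := hK.continuous.integrable_of_hasCompactSupport
    (HasCompactSupport.of_compactSpace f)
  have hintc : Integrable (fun y => f y - c) υ := hint.sub (integrable_const c)
  have hpos : 0 < υ.real (ball x r) :=
    ENNReal.toReal_pos (h.measure_ball_pos x hr).ne' (by finiteness)
  have hpos2 : 0 < υ.real (ball x (2 * r)) :=
    ENNReal.toReal_pos (h.measure_ball_pos x (by positivity)).ne' (by finiteness)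
  have hsub : ball x r ⊆ ball x (2 * r) := ball_subset_ball (by linarith)
  calc |(⨍ y in ball x r, f y ∂υ) - c|
      = |(υ.real (ball x r))⁻¹ * ∫ y in ball x r, (f y - c) ∂υ| := by
        rw [setAverage_eq, integral_sub hint.integrableOn (integrable_const c), setIntegral_const,
          smul_eq_mul, smul_eq_mul]
        congr 1
        field_simp
    _ ≤ (υ.real (ball x r))⁻¹ * ∫ y in ball x r, |f y - c| ∂υ := by
        rw [abs_mul, abs_of_pos (inv_pos.2 hpos)]
        gcongr
        exact abs_integral_le_integral_abs
    _ ≤ (υ.real (ball x r))⁻¹ * ∫ y in ball x (2 * r), |f y - c| ∂υ := by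
        gcongr
        · exact Eventually.of_forall fun _ => abs_nonneg _
        · exact hintc.abs.integrableOn
    _ ≤ 2 ^ κ * ((υ.real (ball x (2 * r)))⁻¹ * ∫ y in ball x (2 * r), |f y - c| ∂υ) := by
        rw [← mul_assoc]
        refine mul_le_mul_of_nonneg_right ?_ (integral_nonneg fun _ => abs_nonneg _)
        rw [← div_eq_mul_inv, inv_le_comm₀ hpos (by positivity), inv_div,
          div_le_iff₀' (by positivity)]
        exact h.measureReal_le x hr
    _ ≤ _ := by
        rw [setAverage_eq, smul_eq_mul] at hP'
        gcongr

lemma measurable_ball_average [IsProbabilityMeasure υ] {f : X → ℝ} (hf : Measurable f) (r : ℝ) :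
    Measurable fun x => ⨍ y in ball x r, f y ∂υ := by
  have hs : MeasurableSet {q : X × X | dist q.2 q.1 < r} :=
    (isOpen_lt (continuous_snd.dist continuous_fst) continuous_const).measurableSet
  simp only [setAverage_eq, smul_eq_mul]
  refine (measurable_measure_ball r).ennreal_toReal.inv.mul ?_
  simp only [← integral_indicator measurableSet_ball]
  exact (((hf.comp measurable_snd).indicator hs).stronglyMeasurable.integral_prod_right').measurable
lemma eLpNorm_average_sub_average_le [IsProbabilityMeasure υ] {κ τ p : ℝ} (hp : 0 < p)
    (hτ : 0 < τ) (h : DoublingFor υ κ) (hP : PoincareFor υ 1 p τ) {f : X → ℝ} (hf : IsLipFun f)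
    {r : ℝ} (hr : 0 < r) :
    eLpNorm (fun x => (⨍ y in ball x r, f y ∂υ) - ⨍ y in ball x (2 * r), f y ∂υ)
        (ENNReal.ofReal p) υ ≤
      ENNReal.ofReal (2 ^ κ * (τ * (2 * r))) *
        (2 ^ κ * ∫⁻ y, ENNReal.ofReal ((pLip f y) ^ p) ∂υ) ^ (1 / p) := by
  have hg : Measurable fun y => ENNReal.ofReal ((pLip f y) ^ p) := by
    obtain ⟨K, hK⟩ := hf
    exact ((measurable_pLip hK).pow_const p).ennreal_ofReal
  have hgnn : ∀ y, 0 ≤ (pLip f y) ^ p := fun y => Real.rpow_nonneg (pLip_nonneg f y) p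
  rw [eLpNorm_eq_lintegral_rpow_enorm_toReal (by simpa using hp) ENNReal.ofReal_ne_top,
    ENNReal.toReal_ofReal hp.le]
  set c := 2 ^ κ * (τ * (2 * r)) with hc
  have hc0 : 0 ≤ c := by positivity
  have hpt : ∀ x, ‖(⨍ y in ball x r, f y ∂υ) - ⨍ y in ball x (2 * r), f y ∂υ‖ₑ ^ p ≤
      ENNReal.ofReal c ^ p * ((υ (ball x (2 * r)))⁻¹ *
        ∫⁻ y in ball x (2 * r), ENNReal.ofReal ((pLip f y) ^ p) ∂υ) := by
    intro x
    have hpos : 0 < υ.real (ball x (2 * r)) :=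
      ENNReal.toReal_pos (h.measure_ball_pos x (by positivity)).ne' (by finiteness)
    have hav : ENNReal.ofReal (⨍ y in ball x (2 * r), (pLip f y) ^ p ∂υ) =
        (υ (ball x (2 * r)))⁻¹ *
          ∫⁻ y in ball x (2 * r), ENNReal.ofReal ((pLip f y) ^ p) ∂υ := by
      rw [setAverage_eq, smul_eq_mul, ENNReal.ofReal_mul (by positivity),
        ENNReal.ofReal_inv_of_pos hpos, ofReal_measureReal (by finiteness),
        ofReal_integral_eq_lintegral_ofReal (integrable_pLip_rpow hf hp.le).integrableOn
          (Eventually.of_forall hgnn)]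
    have havnn : 0 ≤ ⨍ y in ball x (2 * r), (pLip f y) ^ p ∂υ := by
      rw [setAverage_eq, smul_eq_mul]
      exact mul_nonneg (by positivity) (integral_nonneg hgnn)
    rw [← hav]
    calc _ ≤ (ENNReal.ofReal (c * (⨍ y in ball x (2 * r), (pLip f y) ^ p ∂υ) ^ (1 / p))) ^ p := by
          rw [Real.enorm_eq_ofReal_abs]
          gcongr
          refine (abs_average_sub_average_le h hP hf x hr).trans_eq ?_
          rw [hc]
          ring
      _ = _ := by
          rw [ENNReal.ofReal_mul hc0, ENNReal.mul_rpow_of_nonneg _ _ hp.le,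
            ENNReal.ofReal_rpow_of_nonneg (p := p) (Real.rpow_nonneg havnn _) hp.le,
            ← Real.rpow_mul havnn, one_div_mul_cancel hp.ne', Real.rpow_one]
  calc _ ≤ (ENNReal.ofReal c ^ p *
        (2 ^ κ * ∫⁻ y, ENNReal.ofReal ((pLip f y) ^ p) ∂υ)) ^ (1 / p) := by
        refine ENNReal.rpow_le_rpow ?_ (by positivity)
        refine (lintegral_mono hpt).trans ?_
        rw [lintegral_const_mul' _ _ (by finiteness)]
        gcongr
        exact h.lintegral_ball_average_le (by positivity) hg
    _ = _ := by
        rw [ENNReal.mul_rpow_of_nonneg _ _ (by positivity), ← ENNReal.rpow_mul,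
          mul_one_div_cancel hp.ne', ENNReal.rpow_one]

lemma eLpNorm_average_sub_average_two_pow_le [IsProbabilityMeasure υ] {κ τ p : ℝ} (hp : 1 ≤ p)
    (hτ : 0 < τ) (h : DoublingFor υ κ) (hP : PoincareFor υ 1 p τ) {f : X → ℝ} (hf : IsLipFun f)
    {R : ℝ} (hR : 0 < R) (n : ℕ) :
    eLpNorm (fun x => (⨍ y in ball x (R / 2 ^ n), f y ∂υ) - ⨍ y in ball x R, f y ∂υ)
        (ENNReal.ofReal p) υ ≤
      ENNReal.ofReal (2 ^ κ * (τ * (2 * (R - R / 2 ^ n)))) *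
        (2 ^ κ * ∫⁻ y, ENNReal.ofReal ((pLip f y) ^ p) ∂υ) ^ (1 / p) := by
  have hmeas : ∀ r : ℝ, AEStronglyMeasurable (fun x => ⨍ y in ball x r, f y ∂υ) υ := by
    obtain ⟨K, hK⟩ := hf
    exact fun r => (measurable_ball_average hK.continuous.measurable r).aestronglyMeasurable
  induction n with
  | zero => simp
  | succ n ih =>
    have hstep := eLpNorm_average_sub_average_le (r := R / 2 ^ (n + 1)) (by linarith) hτ h hP hf
      (by positivity)
    have h2 : 2 * (R / 2 ^ (n + 1)) = R / 2 ^ n := by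
      rw [pow_succ]
      field_simp
    rw [h2] at hstep
    have hle : R / 2 ^ n ≤ R := div_le_self hR.le (one_le_pow₀ one_le_two)
    have hsplit : (fun x => (⨍ y in ball x (R / 2 ^ (n + 1)), f y ∂υ) - ⨍ y in ball x R, f y ∂υ) =
        (fun x => (⨍ y in ball x (R / 2 ^ (n + 1)), f y ∂υ) - ⨍ y in ball x (R / 2 ^ n), f y ∂υ) +
        fun x => (⨍ y in ball x (R / 2 ^ n), f y ∂υ) - ⨍ y in ball x R, f y ∂υ := by
      ext x
      simp
    rw [hsplit]
    refine (eLpNorm_add_le ((hmeas _).sub (hmeas _)) ((hmeas _).sub (hmeas _))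
      (by simpa using hp)).trans ((add_le_add hstep ih).trans_eq ?_)
    rw [← add_mul, ← ENNReal.ofReal_add (by positivity)
      (mul_nonneg (by positivity) (mul_nonneg hτ.le (by linarith)))]
    congr 2
    rw [← h2]
    ring

/-- A `(1, p)`-Poincaré inequality on a compact doubling space implies the global
`(p, p)`-Poincaré inequality. -/
lemma eLpNorm_sub_integral_le [IsProbabilityMeasure υ] {κ τ p : ℝ} (hp : 1 ≤ p)
    (hτ : 0 < τ) (h : DoublingFor υ κ) (hP : PoincareFor υ 1 p τ) {f : X → ℝ} (hf : IsLipFun f)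
    (hd : 0 < diam (univ : Set X)) :
    eLpNorm (fun x => f x - ∫ y, f y ∂υ) (ENNReal.ofReal p) υ ≤
      ENNReal.ofReal (2 ^ κ * (τ * (4 * diam (univ : Set X)))) *
        (2 ^ κ * ∫⁻ y, ENNReal.ofReal ((pLip f y) ^ p) ∂υ) ^ (1 / p) := by
  obtain ⟨K, hK⟩ := id hf
  set R := 2 * diam (univ : Set X) with hRdef
  have hR : 0 < R := by positivity
  have hint : Integrable f υ := hK.continuous.integrable_of_hasCompactSupport
    (HasCompactSupport.of_compactSpace f)
  have hmeas : ∀ r : ℝ, AEStronglyMeasurable (fun x => ⨍ y in ball x r, f y ∂υ) υ :=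
    fun r => (measurable_ball_average hK.continuous.measurable r).aestronglyMeasurable
  have hav : ∀ x : X, ⨍ y in ball x R, f y ∂υ = ∫ y, f y ∂υ := by
    intro x
    rw [ball_eq_univ_of_diam_lt (by linarith), setAverage_eq]
    simp
  have hclose : ∀ n : ℕ, eLpNorm (fun x => f x - ⨍ y in ball x (R / 2 ^ n), f y ∂υ)
      (ENNReal.ofReal p) υ ≤ ENNReal.ofReal (K * (R / 2 ^ n)) := by
    intro n
    have hn : 0 < R / 2 ^ n := by positivity
    refine (eLpNorm_le_of_ae_bound (C := K * (R / 2 ^ n)) (Eventually.of_forall fun x => ?_)).trans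
      (by simp)
    have hpos : 0 < υ.real (ball x (R / 2 ^ n)) :=
      ENNReal.toReal_pos (h.measure_ball_pos x hn).ne' (by finiteness)
    have hb := norm_setIntegral_le_of_norm_le_const (μ := υ) (s := ball x (R / 2 ^ n))
      (f := fun y => f x - f y) (C := K * (R / 2 ^ n)) (by finiteness) (fun y hy => by
        rw [← dist_eq_norm]
        exact (hK.dist_le_mul x y).trans (by gcongr; exact (mem_ball'.1 hy).le))
    rw [integral_sub (integrable_const _) hint.integrableOn, setIntegral_const, smul_eq_mul] at hb
    have heq : f x - ⨍ y in ball x (R / 2 ^ n), f y ∂υ = (υ.real (ball x (R / 2 ^ n)))⁻¹ *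
        (υ.real (ball x (R / 2 ^ n)) * f x - ∫ y in ball x (R / 2 ^ n), f y ∂υ) := by
      rw [setAverage_eq, smul_eq_mul]
      field_simp
    rw [heq, norm_mul, norm_inv, Real.norm_of_nonneg hpos.le, inv_mul_le_iff₀ hpos]
    linarith
  have hbound : ∀ n : ℕ, eLpNorm (fun x => f x - ∫ y, f y ∂υ) (ENNReal.ofReal p) υ ≤
      ENNReal.ofReal (K * (R / 2 ^ n)) +
      ENNReal.ofReal (2 ^ κ * (τ * (4 * diam (univ : Set X)))) *
        (2 ^ κ * ∫⁻ y, ENNReal.ofReal ((pLip f y) ^ p) ∂υ) ^ (1 / p) := by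
    intro n
    have hsplit : (fun x => f x - ∫ y, f y ∂υ) =
        (fun x => f x - ⨍ y in ball x (R / 2 ^ n), f y ∂υ) +
        fun x => (⨍ y in ball x (R / 2 ^ n), f y ∂υ) - ⨍ y in ball x R, f y ∂υ := by
      ext x
      simp [hav x]
    rw [hsplit]
    refine (eLpNorm_add_le (hint.aestronglyMeasurable.sub (hmeas _)) ((hmeas _).sub (hmeas _))
      (by simpa using hp)).trans (add_le_add (hclose n) ?_)
    refine (eLpNorm_average_sub_average_two_pow_le hp hτ h hP hf hR n).trans ?_
    refine mul_le_mul_left (ENNReal.ofReal_le_ofReal ?_) _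
    have : 0 < R / 2 ^ n := by positivity
    gcongr ?_ * (?_ * ?_)
    linarith
  have hlim : Tendsto (fun n : ℕ => ENNReal.ofReal (K * (R / 2 ^ n)) +
      ENNReal.ofReal (2 ^ κ * (τ * (4 * diam (univ : Set X)))) *
        (2 ^ κ * ∫⁻ y, ENNReal.ofReal ((pLip f y) ^ p) ∂υ) ^ (1 / p)) atTop
      (𝓝 (0 + ENNReal.ofReal (2 ^ κ * (τ * (4 * diam (univ : Set X)))) *
        (2 ^ κ * ∫⁻ y, ENNReal.ofReal ((pLip f y) ^ p) ∂υ) ^ (1 / p))) := by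
    refine Tendsto.add ?_ tendsto_const_nhds
    have h0 : Tendsto (fun n : ℕ => (K : ℝ) * (R / 2 ^ n)) atTop (𝓝 (K * (R * 0))) := by
      refine (Tendsto.const_mul R ?_).const_mul _
      exact tendsto_inv_atTop_zero.comp (tendsto_pow_atTop_atTop_of_one_lt one_lt_two)
    simpa using ENNReal.tendsto_ofReal h0
  rw [zero_add] at hlim
  exact ge_of_tendsto' hlim hbound

lemma abs_rpow_sub_mul_le {p : ℝ} (hp : 1 < p) (a c : ℝ) :
    |a| ^ p - c * (|a| ^ (p - 2) * a) ≤ (1 - 1 / p) * |a| ^ p + 1 / p * |a - c| ^ p := by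
  have hp0 : 0 < p := by linarith
  rcases eq_or_ne a 0 with rfl | ha
  · simp only [abs_zero, Real.zero_rpow hp0.ne', mul_zero, sub_zero, zero_add]
    positivity
  have habs : 0 < |a| := abs_pos.2 ha
  have h1 : |a| ^ p = |a| ^ (p - 2) * a * a := by
    rw [mul_assoc, ← abs_mul_abs_self, ← mul_assoc, ← Real.rpow_add_one habs.ne',
      ← Real.rpow_add_one habs.ne']
    congr 1
    ring
  have h2 : |a| ^ (p - 1) = |a| ^ (p - 2) * |a| := by
    rw [← Real.rpow_add_one habs.ne']
    congr 1
    ring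
  have hpq : (p / (p - 1)).HolderConjugate p := (Real.HolderConjugate.conjExponent hp).symm
  have hyoung := Real.young_inequality_of_nonneg (Real.rpow_nonneg habs.le (p - 1))
    (abs_nonneg (a - c)) hpq
  rw [← Real.rpow_mul habs.le, mul_div_cancel₀ _ (by linarith)] at hyoung
  calc |a| ^ p - c * (|a| ^ (p - 2) * a) = |a| ^ (p - 2) * a * (a - c) := by rw [h1]; ring
    _ ≤ |a| ^ (p - 1) * |a - c| := by
        refine (le_abs_self _).trans_eq ?_
        rw [abs_mul, abs_mul, abs_of_nonneg (Real.rpow_nonneg habs.le _), h2]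
    _ ≤ _ := hyoung
    _ = _ := by
        field_simp

/-- If `∫ |f| ^ (p - 2) * f = 0`, then `c = 0` minimises `∫ |f - c| ^ p`. -/
lemma integral_abs_rpow_le_integral_abs_sub_rpow [IsProbabilityMeasure υ] {p : ℝ} (hp : 1 < p)
    {f : X → ℝ} (hf : Continuous f) (horth : ∫ x, |f x| ^ (p - 2) * f x ∂υ = 0) (c : ℝ) :
    ∫ x, |f x| ^ p ∂υ ≤ ∫ x, |f x - c| ^ p ∂υ := by
  have hp0 : 0 < p := by linarith
  have hint : ∀ b, Integrable (fun x => |f x - b| ^ p) υ := fun b =>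
    ((hf.sub continuous_const).abs.rpow_const
      fun _ => Or.inr hp0.le).integrable_of_hasCompactSupport
      (HasCompactSupport.of_compactSpace _)
  have hint0 : Integrable (fun x => |f x| ^ p) υ := by simpa using hint 0
  have hint2 : Integrable (fun x => |f x| ^ (p - 2) * f x) υ := by
    have hi : Integrable (fun x => |f x| ^ (p - 1)) υ :=
      (hf.abs.rpow_const fun _ => Or.inr (by linarith)).integrable_of_hasCompactSupport
        (HasCompactSupport.of_compactSpace _)
    refine hi.mono' ((hf.measurable.abs.pow_const _).mul hf.measurable).aestronglyMeasurable
      (Eventually.of_forall fun x => ?_)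
    rcases eq_or_ne (f x) 0 with h0 | h0
    · simp only [h0, mul_zero, norm_zero]
      positivity
    · rw [norm_mul, Real.norm_of_nonneg (by positivity), Real.norm_eq_abs,
        ← Real.rpow_add_one (abs_pos.2 h0).ne']
      exact (congrArg _ (by ring)).le
  have hmono := integral_mono (hint0.sub (hint2.const_mul c))
    ((hint0.const_mul (1 - 1 / p)).add ((hint c).const_mul (1 / p)))
    fun x => abs_rpow_sub_mul_le hp (f x) c
  rw [integral_sub' hint0 (hint2.const_mul c),
    integral_add' (hint0.const_mul (1 - 1 / p)) ((hint c).const_mul (1 / p)),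
    integral_const_mul, integral_const_mul, integral_const_mul, horth, mul_zero, sub_zero] at hmono
  have hpos : 0 < 1 / p := by positivity
  nlinarith

lemma ofReal_le_lambda1_rpow [IsProbabilityMeasure υ] {κ τ p : ℝ} (hp : 1 < p)
    (hτ : 0 < τ) (h : DoublingFor υ κ) (hP : PoincareFor υ 1 p τ)
    (hd : 0 < diam (univ : Set X)) :
    ENNReal.ofReal (1 / (2 ^ κ * (τ * 4) * (2 ^ κ) ^ (1 / p) * diam (univ : Set X))) ≤
      lambda1 υ p ^ (1 / p) := by
  have hp0 : 0 < p := by linarith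
  rw [one_div p, ENNReal.le_rpow_inv_iff hp0]
  refine le_iInf₂ fun f hf => ?_
  obtain ⟨⟨K, hK⟩, hnorm, horth⟩ := hf
  rw [← ENNReal.le_rpow_inv_iff hp0, ← one_div]
  have hmain := eLpNorm_sub_integral_le hp.le hτ h hP ⟨K, hK⟩ hd
  set c := ∫ y, f y ∂υ
  have hgint := integrable_pLip_rpow (υ := υ) ⟨K, hK⟩ hp0.le
  have hle := integral_abs_rpow_le_integral_abs_sub_rpow hp hK.continuous horth c
  have hone : 1 ≤ eLpNorm (fun x => f x - c) (ENNReal.ofReal p) υ := by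
    rw [eLpNorm_eq_lintegral_rpow_enorm_toReal (by simpa using hp0) ENNReal.ofReal_ne_top,
      ENNReal.toReal_ofReal hp0.le, one_div, ENNReal.le_rpow_inv_iff hp0, ENNReal.one_rpow]
    have hint : Integrable (fun x => |f x - c| ^ p) υ :=
      ((hK.continuous.sub continuous_const).abs.rpow_const
        fun _ => Or.inr hp0.le).integrable_of_hasCompactSupport
        (HasCompactSupport.of_compactSpace _)
    simp only [Real.enorm_eq_ofReal_abs, ENNReal.ofReal_rpow_of_nonneg (abs_nonneg _) hp0.le]
    rw [← ofReal_integral_eq_lintegral_ofReal hint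
      (Eventually.of_forall fun _ => Real.rpow_nonneg (abs_nonneg _) _), ENNReal.one_le_ofReal]
    linarith
  rw [← ofReal_integral_eq_lintegral_ofReal hgint
      (Eventually.of_forall fun y => Real.rpow_nonneg (pLip_nonneg f y) _),
    two_rpow_eq_ofReal, ENNReal.mul_rpow_of_nonneg _ _ (by positivity), ← mul_assoc,
    ENNReal.ofReal_rpow_of_nonneg (x := 2 ^ κ) (by positivity) (by positivity),
    ← ENNReal.ofReal_mul (by positivity)] at hmain
  rw [one_div (_ * diam _), ENNReal.ofReal_inv_of_pos (by positivity),
    ← one_div (ENNReal.ofReal _)]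
  refine ENNReal.div_le_of_le_mul' ((hone.trans hmain).trans_eq ?_)
  congr 2
  ring

lemma ofReal_le_cheeger [IsProbabilityMeasure υ] {τ : ℝ} (hτ : 0 < τ)
    (hP : PoincareFor υ 1 1 τ) (hd : 0 < diam (univ : Set X)) :
    ENNReal.ofReal (1 / ((16 * τ + 4) * diam (univ : Set X))) ≤ cheeger υ := by
  set d := diam (univ : Set X)
  refine le_iInf₂ fun A hA => ?_
  obtain ⟨hAm, hA0, hA2⟩ := hA
  have hAne : A.Nonempty := nonempty_of_measure_ne_zero hA0.ne'
  rw [ENNReal.le_div_iff_mul_le (Or.inl hA0.ne') (Or.inl (by finiteness))]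
  refine le_liminf_of_le (by isBoundedDefault) ?_
  filter_upwards [Ioo_mem_nhdsGT hd] with r ⟨hr0, hrd⟩
  have hsub : A ⊆ thickening r A := self_subset_thickening hr0 A
  have hdiff : υ (thickening r A) - υ A = ENNReal.ofReal (υ.real (thickening r A) - υ.real A) := by
    rw [ENNReal.ofReal_sub _ measureReal_nonneg, ofReal_measureReal, ofReal_measureReal]
  rw [hdiff, ← ENNReal.ofReal_div_of_pos hr0, ← ofReal_measureReal (μ := υ) (s := A),
    ← ENNReal.ofReal_mul (by positivity)]
  refine ENNReal.ofReal_le_ofReal ?_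
  have ha2 : υ.real A ≤ 1 / 2 := by
    simpa [measureReal_def] using ENNReal.toReal_mono (by finiteness) hA2
  have haT : υ.real A ≤ υ.real (thickening r A) := measureReal_mono hsub
  set a := υ.real A
  set T := υ.real (thickening r A) with hT
  have ha0 : 0 ≤ a := measureReal_nonneg
  rw [one_div_mul_eq_div, div_le_div_iff₀ (by positivity) hr0]
  rcases le_or_gt T (3 / 4) with hT34 | hT34
  · set f : X → ℝ := fun x => max 0 (min 1 ((3 * r / 4 - infDist x A) * (2 / r))) with hf
    have hf1 : ∀ x, infDist x A ≤ r / 4 → f x = 1 := by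
      intro x hx
      have : 1 ≤ (3 * r / 4 - infDist x A) * (2 / r) := by
        rw [mul_div_assoc', le_div_iff₀ hr0]
        linarith
      simp [hf, min_eq_left this]
    have hf0 : ∀ x, 3 * r / 4 ≤ infDist x A → f x = 0 := by
      intro x hx
      have : (3 * r / 4 - infDist x A) * (2 / r) ≤ 0 :=
        mul_nonpos_of_nonpos_of_nonneg (by linarith) (by positivity)
      exact max_eq_left ((min_le_right _ _).trans this)
    have hlip : LipschitzWith (Real.toNNReal (2 / r)) f := by
      refine LipschitzWith.const_max (LipschitzWith.const_min ?_ 1) 0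
      refine LipschitzWith.of_dist_le_mul fun x y => ?_
      have := (lipschitz_infDist_pt A).dist_le_mul x y
      rw [Real.coe_toNNReal _ (by positivity), Real.dist_eq, ← sub_mul, abs_mul,
        abs_of_pos (a := 2 / r) (by positivity), mul_comm]
      gcongr
      rw [sub_sub_sub_cancel_left, abs_sub_comm, ← Real.dist_eq]
      simpa using this
    have hcont := hlip.continuous
    have hdc : Continuous fun x => infDist x A := continuous_infDist_pt A
    have hnn : ∀ x, 0 ≤ f x := fun x => le_max_left _ _
    have hle1 : ∀ x, f x ≤ 1 := fun x => max_le zero_le_one (min_le_left _ _)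
    have hthick : ∀ x, x ∈ thickening r A ↔ infDist x A < r :=
      fun x => mem_thickening_iff_infDist_lt hAne
    have hTm : MeasurableSet (thickening r A) := isOpen_thickening.measurableSet
    have hint : Integrable f υ :=
      hcont.integrable_of_hasCompactSupport (HasCompactSupport.of_compactSpace f)
    have hlocal : ∀ x, x ∉ thickening r A \ A → pLip f x = 0 := by
      intro x hx
      rcases lt_or_ge (infDist x A) (r / 4) with h1 | h1
      · refine pLip_eq_zero_of_eventually_eq ?_
        filter_upwards [hdc.continuousAt.eventually_lt_const h1] with y hy
        rw [hf1 y hy.le, hf1 x h1.le]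
      · have hxA : x ∉ A := fun hxA => by
          rw [infDist_zero_of_mem hxA] at h1
          linarith
        have h2 : r ≤ infDist x A := by
          by_contra! h2
          exact hx ⟨(hthick x).2 h2, hxA⟩
        have h3 : 3 * r / 4 < infDist x A := by linarith
        refine pLip_eq_zero_of_eventually_eq ?_
        filter_upwards [hdc.continuousAt.eventually_const_lt h3] with y hy
        rw [hf0 y hy.le, hf0 x h3.le]
    have hgrad : ∫ x, pLip f x ∂υ ≤ 2 / r * (T - a) := by
      calc ∫ x, pLip f x ∂υ ≤ ∫ x, (thickening r A \ A).indicator (fun _ => 2 / r) x ∂υ := by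
            refine integral_mono_of_nonneg (Eventually.of_forall fun x => pLip_nonneg f x)
              ((integrable_const _).indicator (hTm.diff hAm)) (Eventually.of_forall fun x => ?_)
            by_cases hx : x ∈ thickening r A \ A
            · simpa [hx, Real.coe_toNNReal _ (show 0 ≤ 2 / r by positivity)] using
                pLip_le_of_lipschitzWith hlip x
            · simp [hx, hlocal x hx]
        _ = 2 / r * (T - a) := by
            rw [integral_indicator_const _ (hTm.diff hAm), measureReal_sdiff hsub hAm, smul_eq_mul,
              mul_comm]
    have hm : ∫ x, f x ∂υ ≤ 3 / 4 := by
      refine le_trans ?_ hT34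
      calc ∫ x, f x ∂υ ≤ ∫ x, (thickening r A).indicator (fun _ => (1 : ℝ)) x ∂υ := by
            refine integral_mono hint ((integrable_const _).indicator hTm) fun x => ?_
            by_cases hx : x ∈ thickening r A
            · simpa [hx] using hle1 x
            · have : r ≤ infDist x A := not_lt.1 fun h => hx ((hthick x).2 h)
              simp [hx, hf0 x (by linarith)]
        _ = T := by
            rw [integral_indicator_const _ hTm, smul_eq_mul, mul_one]
    have hlow : a * (1 / 4) ≤ ∫ x, |f x - ∫ y, f y ∂υ| ∂υ := by
      calc a * (1 / 4) = ∫ x, A.indicator (fun _ => (1 / 4 : ℝ)) x ∂υ := by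
            rw [integral_indicator_const _ hAm, smul_eq_mul]
        _ ≤ _ := by
            refine integral_mono ((integrable_const _).indicator hAm)
              (hint.sub (integrable_const _)).abs fun x => ?_
            by_cases hx : x ∈ A
            · have : f x = 1 := hf1 x (by rw [infDist_zero_of_mem hx]; positivity)
              simp only [hx, indicator_of_mem, this]
              exact le_trans (by linarith) (le_abs_self _)
            · simp [hx]
    have hPf := hP.integral_abs_sub_integral_le ⟨_, hlip⟩ hd
    simp only [Real.rpow_one, div_one] at hPf
    have hchain : a * (1 / 4) ≤ τ * (2 * d) * (2 / r * (T - a)) :=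
      (hlow.trans hPf).trans (by gcongr)
    have hchain' : a * r ≤ 16 * τ * d * (T - a) := by
      have := mul_le_mul_of_nonneg_right hchain (by positivity : 0 ≤ 4 * r)
      field_simp at this
      linarith
    nlinarith [mul_nonneg hd.le (sub_nonneg.2 haT)]
  · have h1 : a * r ≤ 1 / 2 * d := mul_le_mul ha2 hrd.le hr0.le (by norm_num)
    have h2 : 0 ≤ τ * d * (T - a) := mul_nonneg (by positivity) (sub_nonneg.2 haT)
    nlinarith [mul_le_mul_of_nonneg_right (show 1 / 4 ≤ T - a by linarith) hd.le]

end Doubling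

/-- uniform lower bound `λ_{1,p}(X)^{1/p} ≥ 1/(C · diam X)`, with `λ_{1,1} := h(X)`. -/
theorem stmt19 :
    ∀ p : ℝ, 1 ≤ p → ∀ κ : ℝ, 0 < κ → ∀ τ : ℝ, 0 < τ →
      ∃ C : ℝ, 0 < C ∧
        ∀ (X : Type) [MetricSpace X] [CompactSpace X] [MeasurableSpace X] [BorelSpace X]
          (υ : Measure X), IsProbabilityMeasure υ → (∃ x y : X, x ≠ y) →
          IsGeodesicSpace X → DoublingFor υ κ → PoincareFor υ 1 p τ →
          ENNReal.ofReal (1 / (C * Metric.diam (Set.univ : Set X))) ≤ (lam1 υ p) ^ (1/p) := by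
  intro p hp κ _ τ hτ
  have hdiam : ∀ (X : Type) [MetricSpace X] [CompactSpace X], (∃ x y : X, x ≠ y) →
      0 < diam (univ : Set X) := by
    rintro X _ _ ⟨x, y, hxy⟩
    exact (dist_pos.2 hxy).trans_le
      (dist_le_diam_of_mem isCompact_univ.isBounded (mem_univ x) (mem_univ y))
  rcases hp.eq_or_lt with rfl | hp1
  · refine ⟨16 * τ + 4, by positivity, fun X _ _ _ _ υ _ hX _ _ hP => ?_⟩
    simpa [lam1] using ofReal_le_cheeger hτ hP (hdiam X hX)
  · refine ⟨2 ^ κ * (τ * 4) * (2 ^ κ) ^ (1 / p), by positivity,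
      fun X _ _ _ _ υ _ hX _ hD hP => ?_⟩
    rw [lam1, if_neg hp1.ne']
    exact ofReal_le_lambda1_rpow hp1 hτ hD hP (hdiam X hX)
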